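/- Let n ≥ 1 and 0 ≤ a ≤ n. Define S to be the set of vectors in ℤⁿ of the form e_i + e_j with 1 ≤ i ≤ j ≤ a together with those of the form −e_i − e_j with a+1 ≤ i ≤ j ≤ n (where e_i is the i-th standard basis vector). Let w : ℤⁿ → ℤⁿ be the linear map induced by the index reversal i ↦ n+1−i. Then w(S) ∩ S = ∅ if and only if 2a = n. -/

import Mathlib

/-- combinatorial core of Theorem 3.2 (type CI).
`e i` is the i-th standard basis vector of ℤⁿ (0-based indices: index `i` stands for
the 1-based index `i+1`). `S` consists of the vectors `e_i + e_j` with `1 ≤ i ≤ j ≤ a`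
and `-e_i - e_j` with `a+1 ≤ i ≤ j ≤ n`. `w` is induced by index reversal. -/
theorem stmt_0 (n a : ℕ) (hn : 1 ≤ n) (ha : a ≤ n)
    (e : Fin n → Fin n → ℤ)
    (he : ∀ i k, e i k = if k = i then 1 else 0)
    (S : Set (Fin n → ℤ))
    (hS : S = {v | ∃ i j : Fin n, i ≤ j ∧ (j : ℕ) < a ∧ v = e i + e j} ∪
              {v | ∃ i j : Fin n, a ≤ (i : ℕ) ∧ i ≤ j ∧ v = -(e i) - e j})
    (w : (Fin n → ℤ) → (Fin n → ℤ))
    (hw : ∀ v k, w v k = v k.rev) :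
    (w '' S) ∩ S = ∅ ↔ 2 * a = n := by
  have he_rev : ∀ i : Fin n, ∀ k, e i k.rev = e i.rev k := by
    intro i k
    simp only [he, Fin.rev_eq_iff]
  have he_nonneg : ∀ i k, 0 ≤ e i k := by
    intro i k
    rw [he]
    split_ifs <;> norm_num
  have he_self : ∀ i, e i i = 1 := fun i => by simp [he]
  have he_zero : ∀ i k, k ≠ i → e i k = 0 := fun i k h => by simp [he, h]
  have sign : ∀ v ∈ S, ∀ k : Fin n,
      ((k : ℕ) < a → 0 ≤ v k) ∧ (a ≤ (k : ℕ) → v k ≤ 0) := by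
    intro v hv k
    rw [hS] at hv
    rcases hv with ⟨i, j, hij, hj, rfl⟩ | ⟨i, j, hi, hij, rfl⟩
    · refine ⟨fun _ => add_nonneg (he_nonneg i k) (he_nonneg j k), fun hk => ?_⟩
      have hij : (i : ℕ) ≤ j := hij
      have hi' : k ≠ i := by rintro rfl; omega
      have hj' : k ≠ j := by rintro rfl; omega
      simp [he_zero _ _ hi', he_zero _ _ hj']
    · have hij : (i : ℕ) ≤ j := hij
      refine ⟨fun hk => ?_, fun _ => ?_⟩
      · have hi' : k ≠ i := by rintro rfl; omega
        have hj' : k ≠ j := by rintro rfl; omega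
        simp [he_zero _ _ hi', he_zero _ _ hj']
      · simp only [Pi.sub_apply, Pi.neg_apply]
        linarith [he_nonneg i k, he_nonneg j k]
  have ne_zero : ∀ v ∈ S, ∃ k, v k ≠ 0 := by
    intro v hv
    rw [hS] at hv
    rcases hv with ⟨i, j, -, -, rfl⟩ | ⟨i, j, -, -, rfl⟩ <;> refine ⟨i, ?_⟩ <;>
      simp only [Pi.add_apply, Pi.sub_apply, Pi.neg_apply, he_self] <;>
      have := he_nonneg j i <;> omega
  constructor
  · intro h
    by_contra hne
    rcases Nat.lt_or_gt_of_ne hne with hlt | hgt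
    · let i : Fin n := ⟨a, by omega⟩
      have hrev : a ≤ (i.rev : ℕ) := by simp only [i, Fin.val_rev]; omega
      refine Set.eq_empty_iff_forall_notMem.mp h (w (-(e i) - e i)) ⟨⟨_, ?_, rfl⟩, ?_⟩
      · rw [hS]
        exact Or.inr ⟨i, i, le_rfl, le_rfl, rfl⟩
      · rw [hS]
        refine Or.inr ⟨i.rev, i.rev, hrev, le_rfl, ?_⟩
        ext k
        simp [hw, he_rev]
    · let i : Fin n := ⟨a - 1, by omega⟩
      have hi : (i : ℕ) < a := by simp only [i]; omega
      have hrev : (i.rev : ℕ) < a := by simp only [i, Fin.val_rev]; omega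
      refine Set.eq_empty_iff_forall_notMem.mp h (w (e i + e i)) ⟨⟨_, ?_, rfl⟩, ?_⟩
      · rw [hS]
        exact Or.inl ⟨i, i, le_rfl, hi, rfl⟩
      · rw [hS]
        refine Or.inl ⟨i.rev, i.rev, le_rfl, hrev, ?_⟩
        ext k
        simp [hw, he_rev]
  · intro h
    rw [Set.eq_empty_iff_forall_notMem]
    rintro _ ⟨⟨v, hv, rfl⟩, hwv⟩
    obtain ⟨k, hk⟩ := ne_zero _ hwv
    have hrev := Fin.val_rev k
    have h₁ := sign _ hwv k
    have h₂ := sign v hv k.rev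
    rw [← hw v k] at h₂
    rcases lt_or_ge (k : ℕ) a with hka | hka
    · exact hk (le_antisymm (h₂.2 (by omega)) (h₁.1 hka))
    · exact hk (le_antisymm (h₁.2 hka) (h₂.1 (by omega)))
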